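/- Let X be a locally finite extended metric space with a paradoxical decomposition, K a field, and K_u(X) its translation algebra acting on the free K-module K[X]. Then K_u(X) is properly infinite; in particular it contains elements u, u', v, v' with uu' = vv' = 1, vu' = uv' = 0, so the Leavitt algebra L_K(1,2) embeds unitally into K_u(X). -/

import Mathlib

open Set

/-- An extended metric space is locally finite if every set of finite diameter
(every closed ball of finite radius) is finite. -/
def LocallyFiniteEMS (X : Type*) [EMetricSpace X] : Prop :=
  ∀ (x : X) (R : ℝ), {y : X | edist x y ≤ ENNReal.ofReal R}.Finite

/-- The `R`-boundary of a set `F` in an extended metric space. -/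
def rBoundary {X : Type*} [EMetricSpace X] (R : ℝ) (F : Set X) : Set X :=
  {x : X | (∃ y ∈ F, edist x y ≤ ENNReal.ofReal R) ∧
           (∃ y ∉ F, edist x y ≤ ENNReal.ofReal R)}

/-- `F` is an `(R, ε)`-Følner set: finite, nonempty, with `|∂_R F| ≤ ε·|F|`. -/
def IsFolnerSet {X : Type*} [EMetricSpace X] (R ε : ℝ) (F : Set X) : Prop :=
  F.Finite ∧ F.Nonempty ∧ ((rBoundary R F).ncard : ℝ) ≤ ε * F.ncard

/-- Amenability of an extended metric space. -/
def Amenable (X : Type*) [EMetricSpace X] : Prop :=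
  ∀ R > (0:ℝ), ∀ ε > (0:ℝ), ∃ F : Set X, IsFolnerSet R ε F

/-- Proper amenability of an extended metric space. -/
def ProperlyAmenable (X : Type*) [EMetricSpace X] : Prop :=
  ∀ R > (0:ℝ), ∀ ε > (0:ℝ), ∀ A : Set X, A.Finite →
    ∃ F : Set X, IsFolnerSet R ε F ∧ A ⊆ F

/-- `t` is a partial translation with domain `A` and range `B`: a bijection from `A`
onto `B` whose graph is controlled, i.e. `sup_{x ∈ A} d(x, t x) < ∞`. -/
def IsPartialTranslation {X : Type*} [EMetricSpace X] (A B : Set X) (t : X → X) : Prop :=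
  Set.BijOn t A B ∧ ∃ C : ℝ, ∀ x ∈ A, edist x (t x) ≤ ENNReal.ofReal C

/-- A paradoxical decomposition of `X`: a partition `X = X₊ ⊔ X₋` together with partial
translations `t₊ : X → X₊`, `t₋ : X → X₋` defined on all of `X`. -/
def Paradoxical (X : Type*) [EMetricSpace X] : Prop :=
  ∃ (Xp Xm : Set X) (tp tm : X → X),
    Xp ∪ Xm = Set.univ ∧ Disjoint Xp Xm ∧
    IsPartialTranslation Set.univ Xp tp ∧ IsPartialTranslation Set.univ Xm tm

open Classical in
/-- The operator on `K[X]` induced by a map `t` defined on the subset `A`: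
`δ_x ↦ δ_{t x}` for `x ∈ A` and `δ_x ↦ 0` otherwise. -/
noncomputable def Vt (K : Type*) {X : Type*} [Field K] (A : Set X) (t : X → X) :
    Module.End K (X →₀ K) :=
  Finsupp.lsum K fun x => if x ∈ A then Finsupp.lsingle (t x) else 0

/-- The translation algebra `K_u(X)`: the unital subalgebra of `End_K(K[X])` generated
by the operators of all partial translations. -/
noncomputable def translationAlgebra (K X : Type*) [Field K] [EMetricSpace X] :
    Subalgebra K (Module.End K (X →₀ K)) :=
  Algebra.adjoin K
    {T | ∃ (A B : Set X) (t : X → X), IsPartialTranslation A B t ∧ T = Vt K A t}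

open Classical in
theorem Vt_single (K : Type*) {X : Type*} [Field K] (A : Set X) (t : X → X) (x : X) (a : K) :
    Vt K A t (Finsupp.single x a) = if x ∈ A then Finsupp.single (t x) a else 0 := by
  simp only [Vt, Finsupp.lsum_single]
  split_ifs <;> simp

theorem Vt_single_of_mem (K : Type*) {X : Type*} [Field K] {A : Set X} (t : X → X) {x : X}
    (hx : x ∈ A) (a : K) : Vt K A t (Finsupp.single x a) = Finsupp.single (t x) a := by
  rw [Vt_single, if_pos hx]

theorem Vt_single_of_notMem (K : Type*) {X : Type*} [Field K] {A : Set X} (t : X → X) {x : X}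
    (hx : x ∉ A) (a : K) : Vt K A t (Finsupp.single x a) = 0 := by
  rw [Vt_single, if_neg hx]

theorem IsPartialTranslation.Vt_mem {X : Type*} [EMetricSpace X] (K : Type*) [Field K]
    {A B : Set X} {t : X → X} (h : IsPartialTranslation A B t) :
    Vt K A t ∈ translationAlgebra K X :=
  Algebra.subset_adjoin ⟨A, B, t, h, rfl⟩

/-- A partial translation defined on all of `X` has an inverse partial translation. -/
theorem IsPartialTranslation.exists_inverse {X : Type*} [EMetricSpace X] {B : Set X}
    {t : X → X} (h : IsPartialTranslation univ B t) :
    ∃ s : X → X, IsPartialTranslation B univ s ∧ (∀ x, s (t x) = x) ∧ ∀ y ∈ B, t (s y) = y := by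
  obtain ⟨hbij, C, hC⟩ := h
  rcases isEmpty_or_nonempty X with hX | hX
  · exact ⟨id, ⟨⟨fun x _ => mem_univ x, fun x => isEmptyElim x, fun x => isEmptyElim x⟩,
      0, fun x => isEmptyElim x⟩, fun x => isEmptyElim x, fun x => isEmptyElim x⟩
  · have hinv := hbij.invOn_invFunOn
    refine ⟨Function.invFunOn t univ, ⟨hbij.symm hinv.symm, C, fun y hy => ?_⟩,
      fun x => hinv.1 (mem_univ x), fun y hy => hinv.2 hy⟩
    have key := hC (Function.invFunOn t univ y) (mem_univ _)
    rwa [hinv.2 hy, edist_comm] at key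

set_option synthInstance.maxHeartbeats 1000000 in
set_option maxHeartbeats 2000000 in
theorem stmt18 {X : Type*} [EMetricSpace X] (K : Type*) [Field K]
    (hlf : LocallyFiniteEMS X) (hpar : Paradoxical X) :
    ∃ u u' v v' : ↥(translationAlgebra K X),
      u * u' = 1 ∧ v * v' = 1 ∧ v * u' = 0 ∧ u * v' = 0 ∧ u' * u + v' * v = 1 := by
  obtain ⟨P, M, p, m, hcover, hdisj, hp, hm⟩ := hpar
  obtain ⟨q, hq, hqp, hpq⟩ := hp.exists_inverse
  obtain ⟨n, hn, hnm, hmn⟩ := hm.exists_inverse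
  have hpP : ∀ x, p x ∈ P := fun x => hp.1.mapsTo (mem_univ x)
  have hmM : ∀ x, m x ∈ M := fun x => hm.1.mapsTo (mem_univ x)
  have hpM : ∀ x, p x ∉ M := fun x => disjoint_left.1 hdisj (hpP x)
  have hmP : ∀ x, m x ∉ P := fun x => disjoint_right.1 hdisj (hmM x)
  refine ⟨⟨Vt K P q, hq.Vt_mem K⟩, ⟨Vt K univ p, hp.Vt_mem K⟩,
    ⟨Vt K M n, hn.Vt_mem K⟩, ⟨Vt K univ m, hm.Vt_mem K⟩, ?_, ?_, ?_, ?_, ?_⟩ <;>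
    refine Subtype.ext (Finsupp.lhom_ext fun x a => ?_)
  · change Vt K P q (Vt K univ p (Finsupp.single x a)) = Finsupp.single x a
    rw [Vt_single_of_mem K p (mem_univ x), Vt_single_of_mem K q (hpP x), hqp]
  · change Vt K M n (Vt K univ m (Finsupp.single x a)) = Finsupp.single x a
    rw [Vt_single_of_mem K m (mem_univ x), Vt_single_of_mem K n (hmM x), hnm]
  · change Vt K M n (Vt K univ p (Finsupp.single x a)) = 0
    rw [Vt_single_of_mem K p (mem_univ x), Vt_single_of_notMem K n (hpM x)]
  · change Vt K P q (Vt K univ m (Finsupp.single x a)) = 0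
    rw [Vt_single_of_mem K m (mem_univ x), Vt_single_of_notMem K q (hmP x)]
  · change Vt K univ p (Vt K P q (Finsupp.single x a)) +
      Vt K univ m (Vt K M n (Finsupp.single x a)) = Finsupp.single x a
    rcases (hcover.symm ▸ mem_univ x : x ∈ P ∪ M) with hx | hx
    · rw [Vt_single_of_mem K q hx, Vt_single_of_notMem K n (disjoint_left.1 hdisj hx),
        Vt_single_of_mem K p (mem_univ _), hpq x hx, map_zero, add_zero]
    · rw [Vt_single_of_mem K n hx, Vt_single_of_notMem K q (disjoint_right.1 hdisj hx),
        Vt_single_of_mem K m (mem_univ _), hmn x hx, map_zero, zero_add]
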